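/- arXiv:1410.5920 — 4 statements merged into one kernel-verified Lean document; each statement's English description precedes it below -/
import Mathlib

section
/- Let D be a probability measure on ℝ^d × ℝ and φ : ℝ^d → ℝ a measurable function with φ(x) > 0 for D-almost every (x,y) and ∫ φ(x) dD(x,y) = 1. Let P_φ be the pushforward under the map T(x,y) = (x/√φ(x), y/√φ(x)) of the measure with density (x,y) ↦ φ(x) with respect to D. Then for every w ∈ ℝ^d, ∫ (xᵀw − y)² dP_φ(x,y) = ∫ (xᵀw − y)² dD(x,y). -/
open MeasureTheory Matrix

/-- The squared loss of any `w` is the same under `P_φ` (the rejection-sampling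
distribution induced by the weight function `φ`) as under `D`. -/
theorem squared_loss_invariant_under_reweighting
    (d : ℕ) (D : Measure ((Fin d → ℝ) × ℝ)) [IsProbabilityMeasure D]
    (φ : (Fin d → ℝ) → ℝ) (hφm : Measurable φ)
    (hφpos : ∀ᵐ q ∂D, 0 < φ q.1)
    (hφ1 : ∫ q, φ q.1 ∂D = 1)
    (T : (Fin d → ℝ) × ℝ → (Fin d → ℝ) × ℝ)
    (hT : T = fun q => ((Real.sqrt (φ q.1))⁻¹ • q.1, q.2 / Real.sqrt (φ q.1)))
    (Pφ : Measure ((Fin d → ℝ) × ℝ))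
    (hPφ : Pφ = Measure.map T (D.withDensity fun q => ENNReal.ofReal (φ q.1)))
    (w : Fin d → ℝ) :
    ∫ q, (q.1 ⬝ᵥ w - q.2) ^ 2 ∂Pφ = ∫ q, (q.1 ⬝ᵥ w - q.2) ^ 2 ∂D := by
  have hTm : Measurable T := by
    rw [hT]
    fun_prop
  have hloss : Measurable fun q : (Fin d → ℝ) × ℝ => (q.1 ⬝ᵥ w - q.2) ^ 2 := by
    simp only [dotProduct]
    fun_prop
  rw [hPφ, integral_map hTm.aemeasurable hloss.aestronglyMeasurable,
    integral_withDensity_eq_integral_toReal_smul (by fun_prop) (by simp)]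
  refine integral_congr_ae ?_
  filter_upwards [hφpos] with q hq
  have hscale : (Real.sqrt (φ q.1))⁻¹ * (q.1 ⬝ᵥ w) - q.2 / Real.sqrt (φ q.1)
      = (q.1 ⬝ᵥ w - q.2) / Real.sqrt (φ q.1) := by
    ring
  simp only [hT, smul_dotProduct, smul_eq_mul, ENNReal.toReal_ofReal hq.le]
  rw [hscale, div_pow, Real.sq_sqrt hq.le, mul_div_cancel₀ _ hq.ne']
end

section
/- Let K ∈ ℕ, and let p₁,…,p_K ≥ 0 with Σ_i p_i = 1. Let μ_i ≥ 0, μ̃_i > 0, α_i ≥ 0, β_i ≥ 0 for i ∈ [K] satisfy μ_i ≤ μ̃_i ≤ μ_i + α_i √μ_i + β_i for all i, and set ρ* = (Σ_{i=1}^K p_i √μ_i)². Then (Σ_{j=1}^K p_j √μ̃_j)(Σ_{i=1}^K p_i μ_i / √μ̃_i) ≤ ρ* + (Σ_i p_i α_i)^{1/2} (ρ*)^{3/4} + (Σ_i p_i β_i)^{1/2} (ρ*)^{1/2}. -/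
/-- Weighted Cauchy–Schwarz for square roots. -/
lemma sum_mul_sqrt_mul_sqrt_le {ι : Type*} (s : Finset ι) {p f g : ι → ℝ}
    (hp : ∀ i, 0 ≤ p i) (hf : ∀ i, 0 ≤ f i) (hg : ∀ i, 0 ≤ g i) :
    ∑ i ∈ s, p i * (√(f i) * √(g i)) ≤ √(∑ i ∈ s, p i * f i) * √(∑ i ∈ s, p i * g i) := by
  refine le_trans (le_of_eq (Finset.sum_congr rfl fun i _ => ?_))
    (Real.sum_sqrt_mul_sqrt_le s (fun i => mul_nonneg (hp i) (hf i))
      (fun i => mul_nonneg (hp i) (hg i)))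
  rw [Real.sqrt_mul (hp i), Real.sqrt_mul (hp i)]
  linear_combination -(√(f i) * √(g i)) * Real.mul_self_sqrt (hp i)

lemma sqrt_add_le_sqrt_add_sqrt {x y : ℝ} (hx : 0 ≤ x) (hy : 0 ≤ y) : √(x + y) ≤ √x + √y := by
  rw [Real.sqrt_le_left (by positivity)]
  nlinarith [Real.sq_sqrt hx, Real.sq_sqrt hy, mul_nonneg (Real.sqrt_nonneg x) (Real.sqrt_nonneg y)]

/-- core inequality of Lemma 2. If the estimates `μ̃_i` satisfy
`μ_i ≤ μ̃_i ≤ μ_i + α_i √μ_i + β_i`, then the stratified risk of the weight vector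
`â_i = √μ̃_i` is at most `ρ* + (Σ p_i α_i)^{1/2} (ρ*)^{3/4} + (Σ p_i β_i)^{1/2} (ρ*)^{1/2}`,
where `ρ* = (Σ p_i √μ_i)²`. -/
theorem stratified_risk_of_estimated_weights
    (K : ℕ) (p μ μt α β : Fin K → ℝ)
    (hp : ∀ i, 0 ≤ p i) (hpsum : ∑ i, p i = 1)
    (hμ : ∀ i, 0 ≤ μ i) (hμt : ∀ i, 0 < μt i)
    (hα : ∀ i, 0 ≤ α i) (hβ : ∀ i, 0 ≤ β i)
    (hbound : ∀ i, μ i ≤ μt i ∧ μt i ≤ μ i + α i * Real.sqrt (μ i) + β i)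
    (ρ : ℝ) (hρ : ρ = (∑ i, p i * Real.sqrt (μ i)) ^ 2) :
    (∑ j, p j * Real.sqrt (μt j)) * (∑ i, p i * μ i / Real.sqrt (μt i))
      ≤ ρ + (∑ i, p i * α i) ^ ((1 : ℝ) / 2) * ρ ^ ((3 : ℝ) / 4)
        + (∑ i, p i * β i) ^ ((1 : ℝ) / 2) * ρ ^ ((1 : ℝ) / 2) := by
  have hS : 0 ≤ ∑ i, p i * √(μ i) :=
    Finset.sum_nonneg fun i _ => mul_nonneg (hp i) (Real.sqrt_nonneg _)
  have hinv : ∑ i, p i * μ i / √(μt i) ≤ ∑ i, p i * √(μ i) := by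
    refine Finset.sum_le_sum fun i _ => ?_
    rw [mul_div_assoc]
    refine mul_le_mul_of_nonneg_left ?_ (hp i)
    rw [div_le_iff₀ (Real.sqrt_pos.2 (hμt i))]
    calc μ i = √(μ i) * √(μ i) := (Real.mul_self_sqrt (hμ i)).symm
      _ ≤ √(μ i) * √(μt i) := by gcongr; exact (hbound i).1
  have hsqrt (i : Fin K) : √(μt i) ≤ √(μ i) + √(α i) * √√(μ i) + √(β i) * √1 := by
    have hαμ : 0 ≤ α i * √(μ i) := mul_nonneg (hα i) (Real.sqrt_nonneg _)
    rw [← Real.sqrt_mul (hα i), Real.sqrt_one, mul_one]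
    linarith [Real.sqrt_le_sqrt (hbound i).2,
      sqrt_add_le_sqrt_add_sqrt (add_nonneg (hμ i) hαμ) (hβ i),
      sqrt_add_le_sqrt_add_sqrt (hμ i) hαμ]
  have hsum : ∑ j, p j * √(μt j) ≤ ∑ i, p i * √(μ i)
      + √(∑ i, p i * α i) * √(∑ i, p i * √(μ i)) + √(∑ i, p i * β i) := by
    have hcsα := sum_mul_sqrt_mul_sqrt_le Finset.univ hp hα fun i => Real.sqrt_nonneg (μ i)
    have hcsβ := sum_mul_sqrt_mul_sqrt_le Finset.univ hp hβ fun _ => zero_le_one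
    simp only [mul_one, hpsum, Real.sqrt_one] at hcsβ
    refine (Finset.sum_le_sum fun i _ => mul_le_mul_of_nonneg_left (hsqrt i) (hp i)).trans ?_
    simp only [mul_add, Finset.sum_add_distrib, Real.sqrt_one, mul_one]
    linarith
  have hinv_nonneg : 0 ≤ ∑ i, p i * μ i / √(μt i) :=
    Finset.sum_nonneg fun i _ => div_nonneg (mul_nonneg (hp i) (hμ i)) (Real.sqrt_nonneg _)
  have hmul := mul_le_mul hsum hinv hinv_nonneg (by positivity)
  generalize ∑ i, p i * √(μ i) = S at *
  have hhalf : ρ ^ ((1 : ℝ) / 2) = S := by rw [hρ, ← Real.sqrt_eq_rpow, Real.sqrt_sq hS]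
  have hthree : ρ ^ ((3 : ℝ) / 4) = √S * S := by
    rw [hρ, ← Real.rpow_natCast_mul hS, Real.sqrt_eq_rpow]
    conv_rhs => rw [← Real.rpow_add_one' hS (by norm_num)]
    norm_num
  rw [hhalf, hthree, ← Real.sqrt_eq_rpow, ← Real.sqrt_eq_rpow, hρ]
  linarith
end

section
/- Let D be a probability measure on ℝ^d × ℝ with Σ = E_D[X Xᵀ] invertible, write ‖x‖_* = √(xᵀ Σ⁻¹ x), and let A ⊆ ℝ^d be measurable with p = D(A × ℝ) > 0 and ‖x‖_* > 0 for D-almost every (x,y) with x ∈ A. Let Θ = (1/p) ∫_{A×ℝ} ‖x‖_*⁴ dD, assumed finite and positive, and let Q be the pushforward under the map N(x,y) = (x/‖x‖_*, y/‖x‖_*) of the measure with density (x,y) ↦ ‖x‖_*⁴ 1[x ∈ A] / (p·Θ) with respect to D. Then: (i) Q is a probability measure; (ii) ‖x‖_* = 1 for Q-almost every (x,y); and (iii) for every w ∈ ℝ^d, Θ · ∫ (xᵀw − y)² dQ(x,y) = (1/p) ∫_{A×ℝ} ‖x‖_*² (xᵀw − y)² dD(x,y). -/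
open MeasureTheory Matrix

/-- A quadratic form scales to one after dividing the vector by the square root of its value. -/
lemma Matrix.dotProduct_mulVec_inv_sqrt_smul {ι : Type*} [Fintype ι] (M : Matrix ι ι ℝ)
    (x : ι → ℝ) (hx : 0 < x ⬝ᵥ (M *ᵥ x)) :
    ((√(x ⬝ᵥ (M *ᵥ x)))⁻¹ • x) ⬝ᵥ (M *ᵥ ((√(x ⬝ᵥ (M *ᵥ x)))⁻¹ • x)) = 1 := by
  have hsqrt := Real.sqrt_pos.2 hx
  have hsq := Real.sq_sqrt hx.le
  rw [mulVec_smul, smul_dotProduct, dotProduct_smul, smul_eq_mul, smul_eq_mul]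
  field_simp
  exact hsq.symm

/-- Reweighting by a density supported on a set of first coordinates is reweighting the
restriction of the measure to the corresponding cylinder. -/
lemma MeasureTheory.Measure.withDensity_ofReal_indicator_fst {α β : Type*} [MeasurableSpace α]
    [MeasurableSpace β] (μ : Measure (α × β)) {A : Set α} (hA : MeasurableSet A) (f : α → ℝ) :
    (μ.withDensity fun q => ENNReal.ofReal (A.indicator f q.1)) =
      (μ.restrict (A ×ˢ Set.univ)).withDensity fun q => ENNReal.ofReal (f q.1) := by
  rw [← withDensity_indicator (hA.prod MeasurableSet.univ)]
  congr 1
  ext q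
  by_cases hq : q.1 ∈ A <;> simp [Set.indicator, hq]

/-- The normalized stratum distribution `Q`, obtained by reweighting `D`
restricted to `A × ℝ` by `‖x‖_*⁴/(pΘ)` and pushing forward under
`(x, y) ↦ (x/‖x‖_*, y/‖x‖_*)`, is a probability measure supported on `{‖x‖_* = 1}`, and
`Θ·E_Q[(xᵀw − y)²] = E_D[‖x‖_*² (xᵀw − y)² | x ∈ A]` for every `w`.
(Here `mah x = ‖x‖_*² = xᵀ Σ⁻¹ x`.) -/
theorem normalized_stratum_distribution
    (d : ℕ) (D : Measure ((Fin d → ℝ) × ℝ)) [IsProbabilityMeasure D]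
    (Sig : Matrix (Fin d) (Fin d) ℝ)
    (hSig : ∀ i j, Sig i j = ∫ q, q.1 i * q.1 j ∂D)
    (hinv : IsUnit Sig.det)
    (mah : (Fin d → ℝ) → ℝ) (hmah : ∀ x, mah x = x ⬝ᵥ (Sig⁻¹ *ᵥ x))
    (A : Set (Fin d → ℝ)) (hAm : MeasurableSet A)
    (p : ℝ) (hp : p = (D (A ×ˢ Set.univ)).toReal) (hppos : 0 < p)
    (hpos : ∀ᵐ q ∂D, q.1 ∈ A → 0 < mah q.1)
    (hint : Integrable (fun q => (mah q.1) ^ 2) (D.restrict (A ×ˢ Set.univ)))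
    (Θ : ℝ) (hΘ : Θ = (1 / p) * ∫ q in A ×ˢ Set.univ, (mah q.1) ^ 2 ∂D) (hΘpos : 0 < Θ)
    (N : (Fin d → ℝ) × ℝ → (Fin d → ℝ) × ℝ)
    (hN : N = fun q => ((Real.sqrt (mah q.1))⁻¹ • q.1, q.2 / Real.sqrt (mah q.1)))
    (Q : Measure ((Fin d → ℝ) × ℝ))
    (hQ : Q = Measure.map N (D.withDensity fun q =>
      ENNReal.ofReal (Set.indicator A (fun x => (mah x) ^ 2 / (p * Θ)) q.1))) :
    IsProbabilityMeasure Q ∧ (∀ᵐ q ∂Q, mah q.1 = 1) ∧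
      ∀ w : Fin d → ℝ, Θ * ∫ q, (q.1 ⬝ᵥ w - q.2) ^ 2 ∂Q
        = (1 / p) * ∫ q in A ×ˢ Set.univ, mah q.1 * (q.1 ⬝ᵥ w - q.2) ^ 2 ∂D := by
  have hmah_meas : Measurable mah := by
    have hcont : Continuous mah := by
      rw [funext hmah]
      fun_prop
    exact hcont.measurable
  have hcyl : MeasurableSet (A ×ˢ (Set.univ : Set ℝ)) := hAm.prod MeasurableSet.univ
  have hN_meas : Measurable N := by
    rw [hN]
    fun_prop
  have hpos_cyl : ∀ᵐ q ∂D.restrict (A ×ˢ Set.univ), 0 < mah q.1 := by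
    rw [ae_restrict_iff' hcyl]
    filter_upwards [hpos] with q hq hqA using hq hqA.1
  have hdens_meas : Measurable fun q : (Fin d → ℝ) × ℝ =>
      ENNReal.ofReal ((mah q.1) ^ 2 / (p * Θ)) := by
    fun_prop
  rw [Measure.withDensity_ofReal_indicator_fst D hAm] at hQ
  subst hQ
  refine ⟨⟨?_⟩, ?_, fun w => ?_⟩
  · have hmass : ∫ q in A ×ˢ Set.univ, (mah q.1) ^ 2 ∂D = p * Θ := by
      rw [hΘ]
      field_simp
    rw [Measure.map_apply hN_meas MeasurableSet.univ, Set.preimage_univ,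
      withDensity_apply _ MeasurableSet.univ, Measure.restrict_univ,
      ← ofReal_integral_eq_lintegral_ofReal (hint.div_const _)
        (Filter.Eventually.of_forall fun q => by positivity),
      integral_div, hmass, div_self (by positivity), ENNReal.ofReal_one]
  · refine (ae_map_iff hN_meas.aemeasurable
      (measurableSet_eq_fun (hmah_meas.comp measurable_fst) measurable_const)).2 ?_
    refine (withDensity_absolutelyContinuous _ _).ae_le ?_
    filter_upwards [hpos_cyl] with q hq
    rw [hmah] at hq
    simp only [hN, hmah, Function.comp_apply]
    exact Matrix.dotProduct_mulVec_inv_sqrt_smul _ _ hq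
  · have hloss : Measurable fun q : (Fin d → ℝ) × ℝ => (q.1 ⬝ᵥ w - q.2) ^ 2 := by
      have hcont : Continuous fun q : (Fin d → ℝ) × ℝ => (q.1 ⬝ᵥ w - q.2) ^ 2 := by
        fun_prop
      exact hcont.measurable
    rw [integral_map hN_meas.aemeasurable hloss.aestronglyMeasurable,
      integral_withDensity_eq_integral_toReal_smul hdens_meas
        (Filter.Eventually.of_forall fun q => ENNReal.ofReal_lt_top),
      ← integral_const_mul, ← integral_const_mul]
    refine integral_congr_ae ?_
    filter_upwards [hpos_cyl] with q hq
    have hsqrt := Real.sqrt_pos.2 hq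
    have hsq := Real.sq_sqrt hq.le
    have hscale : ((√(mah q.1))⁻¹ • q.1) ⬝ᵥ w - q.2 / √(mah q.1) =
        (q.1 ⬝ᵥ w - q.2) / √(mah q.1) := by
      rw [smul_dotProduct, smul_eq_mul]
      ring
    simp only [hN]
    rw [ENNReal.toReal_ofReal (by positivity), hscale, div_pow, hsq, smul_eq_mul]
    field_simp
end

section
/- Let σ > 0, α > 1/√2, p = 1/(2α²), and η ∈ ℝ with |η| ≤ σ/α, and set β = √((1 − pα²)/(1 − p)) and w_opt = pα²η. Define μ₁ = α² · E[(ε + αη − α·w_opt)²] where ε ∼ N(0, σ²), and μ₂ = β⁴ · w_opt². Then μ₁ ≤ (3/2) α² σ², μ₂ ≤ p² α² σ² / (4(1 − p)²), and consequently (p √μ₁ + (1 − p) √μ₂)² ≤ 2 p σ². -/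
open MeasureTheory ProbabilityTheory

/-- The second moment of a translated Gaussian variable. -/
lemma integral_add_const_sq_gaussianReal (m c : ℝ) (v : NNReal) :
    ∫ x, (x + c) ^ 2 ∂(gaussianReal m v) = v + (m + c) ^ 2 := by
  have hid : MemLp (fun x : ℝ => x) 2 (gaussianReal m v) := memLp_id_gaussianReal 2
  have hmem : MemLp (fun x : ℝ => x + c) 2 (gaussianReal m v) := hid.add (memLp_const c)
  have hmean : ∫ x, (x + c) ∂(gaussianReal m v) = m + c := by
    rw [integral_add (hid.integrable (by norm_num)) (integrable_const c),
      integral_id_gaussianReal]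
    simp
  have hvar : variance (fun x : ℝ => x + c) (gaussianReal m v) = v := by
    rw [variance_add_const hid.aestronglyMeasurable]
    exact variance_fun_id_gaussianReal
  have hsub := variance_eq_sub hmem
  rw [hvar, hmean] at hsub
  simp only [Pi.pow_apply] at hsub
  linarith

/-- In the lower-bound example, the stratum quantities satisfy
`μ₁ ≤ (3/2) α² σ²` and `μ₂ ≤ p² α² σ² / (4(1 − p)²)`, hence the oracle risk
`(p√μ₁ + (1 − p)√μ₂)²` is at most `2pσ²`. -/
theorem lower_bound_example_oracle_risk
    (σ α η : ℝ) (hσ : 0 < σ) (hα : 1 / Real.sqrt 2 < α)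
    (p : ℝ) (hp : p = 1 / (2 * α ^ 2)) (hη : |η| ≤ σ / α)
    (β : ℝ) (hβ : β = Real.sqrt ((1 - p * α ^ 2) / (1 - p)))
    (wopt : ℝ) (hw : wopt = p * α ^ 2 * η)
    (μ1 μ2 : ℝ)
    (hμ1 : μ1 = α ^ 2 *
      ∫ ε, (ε + α * η - α * wopt) ^ 2 ∂(gaussianReal 0 (Real.toNNReal (σ ^ 2))))
    (hμ2 : μ2 = β ^ 4 * wopt ^ 2) :
    μ1 ≤ 3 / 2 * α ^ 2 * σ ^ 2 ∧
      μ2 ≤ p ^ 2 * α ^ 2 * σ ^ 2 / (4 * (1 - p) ^ 2) ∧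
      (p * Real.sqrt μ1 + (1 - p) * Real.sqrt μ2) ^ 2 ≤ 2 * p * σ ^ 2 := by
  have hα0 : 0 < α := lt_trans (by positivity) hα
  have hα2 : 1 / 2 < α ^ 2 := by
    have h := pow_lt_pow_left₀ hα (by positivity) two_ne_zero
    rwa [div_pow, Real.sq_sqrt (by norm_num), one_pow] at h
  have hpα : p * α ^ 2 = 1 / 2 := by
    rw [hp]
    field_simp
  have hp0 : 0 < p := by
    rw [hp]
    positivity
  have hq : 0 < 1 - p := by nlinarith
  have hη2 : α ^ 2 * η ^ 2 ≤ σ ^ 2 := by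
    have h : |α * η| ≤ σ := by
      rw [abs_mul, abs_of_pos hα0, mul_comm]
      exact (le_div_iff₀ hα0).1 hη
    rw [← mul_pow]
    exact sq_le_sq' (abs_le.1 h).1 (abs_le.1 h).2
  have hw' : wopt = η / 2 := by
    rw [hw, hpα]
    ring
  have hμ1_eq : μ1 = α ^ 2 * (σ ^ 2 + α ^ 2 * η ^ 2 / 4) := by
    simp only [hμ1, add_sub_assoc]
    rw [integral_add_const_sq_gaussianReal, Real.coe_toNNReal _ (sq_nonneg σ), hw']
    ring
  have hμ1_le : μ1 ≤ 3 / 2 * α ^ 2 * σ ^ 2 := by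
    rw [hμ1_eq]
    nlinarith [mul_le_mul_of_nonneg_left hη2 (sq_nonneg α), sq_nonneg (α * σ)]
  have hβ2 : β ^ 2 = 1 / (2 * (1 - p)) := by
    rw [hβ, hpα, Real.sq_sqrt (div_nonneg (by norm_num) hq.le)]
    field_simp
    norm_num
  have hμ2_eq : μ2 = η ^ 2 / (4 * (2 * (1 - p)) ^ 2) := by
    rw [hμ2, hw', show β ^ 4 = (β ^ 2) ^ 2 by ring, hβ2]
    field_simp
    ring
  have hμ2_le : μ2 ≤ p ^ 2 * α ^ 2 * σ ^ 2 / (4 * (1 - p) ^ 2) := by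
    have hη_le : η ^ 2 ≤ 4 * (p ^ 2 * α ^ 2 * σ ^ 2) := by
      have h := mul_le_mul_of_nonneg_left hη2 (by positivity : 0 ≤ 4 * (p ^ 2 * α ^ 2))
      have h4 : 4 * (p ^ 2 * α ^ 2) * (α ^ 2 * η ^ 2) = η ^ 2 := by
        linear_combination (4 * η ^ 2 * (p * α ^ 2 + 1 / 2)) * hpα
      linarith
    rw [hμ2_eq, div_le_div_iff₀ (by positivity) (by positivity)]
    nlinarith [mul_le_mul_of_nonneg_right hη_le (sq_nonneg (1 - p))]
  refine ⟨hμ1_le, hμ2_le, ?_⟩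
  have hsqrt1 : Real.sqrt μ1 ≤ 3 / 2 * (α * σ) := by
    refine Real.sqrt_le_iff.2 ⟨by positivity, ?_⟩
    nlinarith [sq_nonneg (α * σ)]
  have hsqrt2 : (1 - p) * Real.sqrt μ2 ≤ p * α * σ / 2 := by
    have h : Real.sqrt μ2 ≤ p * α * σ / (2 * (1 - p)) := by
      refine Real.sqrt_le_iff.2 ⟨by positivity, hμ2_le.trans_eq ?_⟩
      field_simp
      norm_num
    calc (1 - p) * Real.sqrt μ2 ≤ (1 - p) * (p * α * σ / (2 * (1 - p))) := by gcongr
      _ = p * α * σ / 2 := by field_simp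
  have hsum : p * Real.sqrt μ1 + (1 - p) * Real.sqrt μ2 ≤ 2 * (p * α * σ) := by
    nlinarith [mul_le_mul_of_nonneg_left hsqrt1 hp0.le]
  calc (p * Real.sqrt μ1 + (1 - p) * Real.sqrt μ2) ^ 2 ≤ (2 * (p * α * σ)) ^ 2 := by gcongr
    _ = 2 * p * σ ^ 2 := by linear_combination 4 * p * σ ^ 2 * hpα
end
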